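/- For F ∈ S(Ω) ⊗ E, G ∈ S(Ω) ⊗ E* and h ∈ H, the integration-by-parts formula E⟨DF(h),G⟩ = E(W(h)⟨F,G⟩) − E⟨F,DG(h)⟩ holds. -/

import Mathlib

open MeasureTheory ProbabilityTheory Filter
open scoped ENNReal NNReal RealInnerProductSpace

/-- `W` is an isonormal Gaussian process on `H` over `(Ω,P)`: `W` is (a.e.) linear in `h`
and each `W h` is a centred Gaussian with variance `‖h‖²`; by polarization this encodes
`E(W h₁ · W h₂) = ⟪h₁,h₂⟫`. -/
def IsIsonormal {Ω H : Type*} [MeasurableSpace Ω]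
    [NormedAddCommGroup H] [InnerProductSpace ℝ H]
    (P : Measure Ω) (W : H → Ω → ℝ) : Prop :=
  (∀ h, AEMeasurable (W h) P) ∧
  (∀ h, P.map (W h) = gaussianReal 0 (‖h‖₊ ^ 2)) ∧
  (∀ h₁ h₂, W (h₁ + h₂) =ᵐ[P] W h₁ + W h₂) ∧
  (∀ (c : ℝ) (h), W (c • h) =ᵐ[P] c • W h)


/-- `f ∈ C_b^∞(ℝⁿ)`: a smooth function which is bounded and has bounded derivatives
of all orders. -/
def CbSmooth {n : ℕ} (f : (Fin n → ℝ) → ℝ) : Prop :=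
  ContDiff ℝ (⊤ : ℕ∞) f ∧ ∀ m : ℕ, ∃ C, ∀ y, ‖iteratedFDeriv ℝ m f y‖ ≤ C


lemma integral_id_mul_gaussianReal {v : ℝ≥0} (hv : v ≠ 0) {ψ ψ' : ℝ → ℝ}
    (hψ : ∀ y, HasDerivAt ψ (ψ' y) y) (hψ' : Continuous ψ') {C C' : ℝ}
    (hC : ∀ y, ‖ψ y‖ ≤ C) (hC' : ∀ y, ‖ψ' y‖ ≤ C') :
    ∫ y, y * ψ y ∂gaussianReal 0 v = v * ∫ y, ψ' y ∂gaussianReal 0 v := by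
  have hcont : Continuous ψ := continuous_iff_continuousAt.2 fun y ↦ (hψ y).continuousAt
  have hpdf : ∀ y, HasDerivAt (gaussianPDFReal 0 v) (-(y / v) * gaussianPDFReal 0 v y) y := by
    intro y
    have hd : HasDerivAt (fun y : ℝ ↦ -(y - 0) ^ 2 / (2 * (v : ℝ))) (-(y / v)) y := by
      refine ((((hasDerivAt_id' y).sub_const 0).fun_pow 2).fun_neg.div_const
        (2 * (v : ℝ))).congr_deriv ?_
      have hv' : (v : ℝ) ≠ 0 := by exact_mod_cast hv
      field_simp
      simp [mul_comm]
    rw [gaussianPDFReal_def]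
    refine (hd.exp.const_mul (√(2 * Real.pi * v))⁻¹).congr_deriv ?_
    ring
  have hid : Integrable (fun y : ℝ ↦ y) (gaussianReal 0 v) :=
    (memLp_id_gaussianReal 1).integrable le_rfl
  have hid_pdf : Integrable (fun y : ℝ ↦ gaussianPDFReal 0 v y * y) := by
    rw [gaussianReal_of_var_ne_zero _ hv,
      integrable_withDensity_iff_integrable_smul' (measurable_gaussianPDF _ _)
        (ae_of_all _ fun _ ↦ gaussianPDF_lt_top)] at hid
    simpa using hid
  have key := integral_mul_deriv_eq_deriv_mul_of_integrable (u := ψ) (u' := ψ')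
    (v := gaussianPDFReal 0 v) (v' := fun y ↦ -(y / v) * gaussianPDFReal 0 v y)
    (fun y _ ↦ hψ y) (fun y _ ↦ hpdf y) ?_ ?_ ?_
  · rw [integral_gaussianReal_eq_integral_smul hv, integral_gaussianReal_eq_integral_smul hv,
      ← integral_const_mul]
    have hv' : (v : ℝ) ≠ 0 := by exact_mod_cast hv
    calc ∫ y, gaussianPDFReal 0 v y • (y * ψ y)
        = -v * ∫ y, ψ y * (-(y / v) * gaussianPDFReal 0 v y) := by
          rw [← integral_const_mul]
          congr with y
          simp only [smul_eq_mul]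
          field_simp
      _ = _ := by
          rw [key, neg_mul_neg, ← integral_const_mul]
          congr with y
          simp only [smul_eq_mul]
          ring
  · have := (hid_pdf.bdd_mul (c := C) hcont.aestronglyMeasurable (ae_of_all _ hC)).const_mul
      (-(v : ℝ)⁻¹)
    refine this.congr (ae_of_all _ fun y ↦ ?_)
    simp only [Pi.mul_apply]
    ring
  · exact (integrable_gaussianPDFReal 0 v).bdd_mul (c := C') hψ'.aestronglyMeasurable
      (ae_of_all _ hC')
  · exact (integrable_gaussianPDFReal 0 v).bdd_mul (c := C) hcont.aestronglyMeasurable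
      (ae_of_all _ hC)

namespace IsIsonormal

variable {Ω H : Type*} [MeasurableSpace Ω] [NormedAddCommGroup H] [InnerProductSpace ℝ H]
  {P : Measure Ω} {W : H → Ω → ℝ}

lemma aemeasurable_pi (hW : IsIsonormal P W) {ι : Type*} [Finite ι] (h : ι → H) :
    AEMeasurable (fun ω l ↦ W (h l) ω) P :=
  have := Fintype.ofFinite ι
  aemeasurable_pi_lambda _ fun l ↦ hW.1 (h l)

lemma map_zero (hW : IsIsonormal P W) : W 0 =ᵐ[P] 0 := by
  simpa using hW.2.2.2 0 0

lemma map_sum_smul (hW : IsIsonormal P W) {ι : Type*} (s : Finset ι) (t : ι → ℝ) (h : ι → H) :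
    W (∑ j ∈ s, t j • h j) =ᵐ[P] fun ω ↦ ∑ j ∈ s, t j * W (h j) ω := by
  classical
  induction s using Finset.induction_on with
  | empty => simp only [Finset.sum_empty]; exact hW.map_zero
  | insert j s hj ih =>
    simp only [Finset.sum_insert hj]
    filter_upwards [ih, hW.2.2.1 (t j • h j) (∑ j ∈ s, t j • h j), hW.2.2.2 (t j) (h j)]
      with ω h₁ h₂ h₃
    rw [h₂, Pi.add_apply, h₁, h₃, Pi.smul_apply, smul_eq_mul]

lemma integral_cexp (hW : IsIsonormal P W) (u : H) :
    ∫ ω, Complex.exp (W u ω * Complex.I) ∂P = Complex.exp (-(‖u‖ ^ 2 : ℝ) / 2) := by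
  have := charFun_gaussianReal (μ := 0) (v := ‖u‖₊ ^ 2) 1
  rw [← hW.2.1 u, charFun_apply_real, integral_map (hW.1 u) (by fun_prop)] at this
  simpa [neg_div] using this

lemma indepFun_of_inner_eq_zero [IsProbabilityMeasure P] (hW : IsIsonormal P W) {ι : Type*}
    [Fintype ι] {k : H} {h : ι → H} (hk : ∀ j, ⟪h j, k⟫ = 0) :
    IndepFun (W k) (fun ω j ↦ W (h j) ω) P := by
  classical
  have hZ := hW.aemeasurable_pi h
  rw [indepFun_iff_charFunDual_prod (hW.1 k) hZ]
  intro L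
  rw [charFunDual_apply, charFunDual_apply, charFunDual_apply,
    integral_map ((hW.1 k).prodMk hZ) (by fun_prop), integral_map (hW.1 k) (by fun_prop),
    integral_map hZ (by fun_prop)]
  set s : ℝ := L (1, 0) with hs
  set t : ι → ℝ := fun j ↦ L (0, Pi.single j 1) with ht
  have hL₁ : ∀ y : ℝ, L (y, 0) = s * y := fun y ↦ by
    rw [show ((y, 0) : ℝ × (ι → ℝ)) = y • (1, 0) by simp, map_smul, smul_eq_mul, mul_comm]
  have hL₂ : ∀ z : ι → ℝ, L (0, z) = ∑ j, t j * z j := fun z ↦ by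
    change (L.comp (.inr ℝ ℝ (ι → ℝ))) z = _
    conv_lhs => rw [pi_eq_sum_univ' z]
    simp [ht, mul_comm]
  have hL : ∀ y z, L (y, z) = s * y + ∑ j, t j * z j := fun y z ↦ by
    rw [← hL₁, ← hL₂, ← map_add]; simp
  set u := ∑ j, t j • h j with hu
  have hu' := hW.map_sum_smul Finset.univ t h
  have hsk := hW.2.2.2 s k
  have horth : ⟪s • k, u⟫ = 0 := by
    simp [hu, inner_smul_left, inner_sum, inner_smul_right, real_inner_comm (h _) k, hk]
  have e₁ : ∫ ω, Complex.exp (L (W k ω, fun j ↦ W (h j) ω) * Complex.I) ∂P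
      = ∫ ω, Complex.exp (W (s • k + u) ω * Complex.I) ∂P := by
    refine integral_congr_ae ?_
    filter_upwards [hu', hsk, hW.2.2.1 (s • k) u] with ω h₁ h₂ h₃
    rw [hL, h₃, Pi.add_apply, h₁, h₂, Pi.smul_apply, smul_eq_mul]
  have e₂ : ∫ ω, Complex.exp ((L.comp (.inl ℝ ℝ (ι → ℝ))) (W k ω) * Complex.I) ∂P
      = ∫ ω, Complex.exp (W (s • k) ω * Complex.I) ∂P := by
    refine integral_congr_ae ?_
    filter_upwards [hsk] with ω h₂
    simp [hL₁, h₂]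
  have e₃ : ∫ ω, Complex.exp ((L.comp (.inr ℝ ℝ (ι → ℝ))) (fun j ↦ W (h j) ω) * Complex.I) ∂P
      = ∫ ω, Complex.exp (W u ω * Complex.I) ∂P := by
    refine integral_congr_ae ?_
    filter_upwards [hu'] with ω h₁
    rw [ContinuousLinearMap.comp_apply, ContinuousLinearMap.inr_apply, hL₂, hu, h₁]
  rw [e₁, e₂, e₃, hW.integral_cexp, hW.integral_cexp, hW.integral_cexp, ← Complex.exp_add,
    pow_two, norm_add_sq_eq_norm_sq_add_norm_sq_real horth]
  congr 1
  push_cast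
  ring

lemma integrable [IsProbabilityMeasure P] (hW : IsIsonormal P W) (k : H) :
    Integrable (W k) P := by
  have : Integrable (fun y : ℝ ↦ y) (P.map (W k)) := by
    rw [hW.2.1 k]
    exact (memLp_id_gaussianReal 1).integrable le_rfl
  exact this.comp_aemeasurable (hW.1 k)

/-- Gaussian integration by parts for a scalar cylindrical functional. -/
lemma integral_mul_comp [IsProbabilityMeasure P] (hW : IsIsonormal P W) {ι : Type*} [Fintype ι]
    (h : ι → H) (k : H) {φ : (ι → ℝ) → ℝ} (hφ : ContDiff ℝ 1 φ) {C C' : ℝ}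
    (hC : ∀ y, ‖φ y‖ ≤ C) (hC' : ∀ y, ‖fderiv ℝ φ y‖ ≤ C') :
    ∫ ω, W k ω * φ (fun l ↦ W (h l) ω) ∂P
      = ∫ ω, fderiv ℝ φ (fun l ↦ W (h l) ω) (fun l ↦ ⟪h l, k⟫) ∂P := by
  rcases eq_or_ne k 0 with rfl | hk
  · have h₀ : ∀ᵐ ω ∂P, W 0 ω * φ (fun l ↦ W (h l) ω) = 0 := by
      filter_upwards [hW.map_zero] with ω hω
      simp [hω]
    rw [integral_congr_ae h₀]
    simp [show (fun _ : ι ↦ (0 : ℝ)) = 0 from rfl]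
  have hk' : ‖k‖ ≠ 0 := norm_ne_zero_iff.2 hk
  have hφc := hφ.continuous
  have hφ'c := hφ.continuous_fderiv one_ne_zero
  set a : ι → ℝ := fun l ↦ ⟪h l, k⟫ / ‖k‖ ^ 2 with ha
  set h' : ι → H := fun l ↦ h l + (-a l) • k with hh'
  have horth : ∀ l, ⟪h' l, k⟫ = 0 := fun l ↦ by
    simp [hh', ha, inner_add_left, inner_smul_left]
    field_simp
    simp
  set Z : Ω → ι → ℝ := fun ω l ↦ W (h' l) ω with hZ
  have hZm : AEMeasurable Z P := hW.aemeasurable_pi h'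
  have hYZ : AEMeasurable (fun ω ↦ (W k ω, Z ω)) P := (hW.1 k).prodMk hZm
  have hdecomp : ∀ᵐ ω ∂P, (fun l ↦ W (h l) ω) = W k ω • a + Z ω := by
    have : ∀ᵐ ω ∂P, ∀ l, W (h' l) ω = W (h l) ω + -a l * W k ω := by
      refine ae_all_iff.2 fun l ↦ ?_
      filter_upwards [hW.2.2.1 (h l) ((-a l) • k), hW.2.2.2 (-a l) k] with ω h₁ h₂
      rw [hh', h₁, Pi.add_apply, h₂, Pi.smul_apply, smul_eq_mul]
    filter_upwards [this] with ω hω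
    ext l
    simp only [Pi.add_apply, Pi.smul_apply, smul_eq_mul, hZ, hω]
    ring
  have hlaw : P.map (fun ω ↦ (W k ω, Z ω)) = (gaussianReal 0 (‖k‖₊ ^ 2)).prod (P.map Z) := by
    rw [← hW.2.1 k]
    exact (indepFun_iff_map_prod_eq_prod_map_map (hW.1 k) hZm).1
      (hW.indepFun_of_inner_eq_zero horth)
  have : IsProbabilityMeasure (P.map Z) := Measure.isProbabilityMeasure_map hZm
  have hv : ‖k‖₊ ^ 2 ≠ 0 := pow_ne_zero 2 (nnnorm_ne_zero_iff.2 hk)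
  set A : ℝ × (ι → ℝ) → (ι → ℝ) := fun p ↦ p.1 • a + p.2 with hA
  have hAc : Continuous A := by fun_prop
  have hFc : Continuous fun p : ℝ × (ι → ℝ) ↦ p.1 * φ (A p) := by fun_prop
  have hDc : Continuous fun p : ℝ × (ι → ℝ) ↦ fderiv ℝ φ (A p) a := by fun_prop
  have hint₁ : Integrable (fun p : ℝ × (ι → ℝ) ↦ p.1 * φ (A p))
      ((gaussianReal 0 (‖k‖₊ ^ 2)).prod (P.map Z)) := by
    have hfst : Integrable (fun p : ℝ × (ι → ℝ) ↦ p.1)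
        ((gaussianReal 0 (‖k‖₊ ^ 2)).prod (P.map Z)) :=
      ((memLp_id_gaussianReal 1).integrable le_rfl).comp_fst _
    exact hfst.mul_bdd (c := C) (hφc.comp hAc).aestronglyMeasurable (ae_of_all _ fun p ↦ hC _)
  have hint₂ : Integrable (fun p : ℝ × (ι → ℝ) ↦ fderiv ℝ φ (A p) a)
      ((gaussianReal 0 (‖k‖₊ ^ 2)).prod (P.map Z)) :=
    .of_bound hDc.aestronglyMeasurable (C' * ‖a‖)
      (ae_of_all _ fun p ↦ ContinuousLinearMap.le_of_opNorm_le _ (hC' _) _)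
  have hstein : ∀ z : ι → ℝ, ∫ y, y * φ (A (y, z)) ∂gaussianReal 0 (‖k‖₊ ^ 2)
      = (‖k‖ ^ 2) * ∫ y, fderiv ℝ φ (A (y, z)) a ∂gaussianReal 0 (‖k‖₊ ^ 2) := fun z ↦ by
    have := integral_id_mul_gaussianReal hv (ψ := fun y ↦ φ (A (y, z)))
      (ψ' := fun y ↦ fderiv ℝ φ (A (y, z)) a) (C := C) (C' := C' * ‖a‖) (fun y ↦ ?_) (by fun_prop)
      (fun y ↦ hC _) (fun y ↦ ContinuousLinearMap.le_of_opNorm_le _ (hC' _) _)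
    · simpa using this
    · have hd : HasDerivAt (fun y : ℝ ↦ A (y, z)) a y := by
        simpa [hA] using ((hasDerivAt_id y).smul_const a).add_const z
      exact ((hφ.differentiable one_ne_zero) _).hasFDerivAt.comp_hasDerivAt y hd
  calc ∫ ω, W k ω * φ (fun l ↦ W (h l) ω) ∂P
      = ∫ ω, W k ω * φ (A (W k ω, Z ω)) ∂P := by
        refine integral_congr_ae ?_
        filter_upwards [hdecomp] with ω hω
        rw [hω]
    _ = ∫ p, p.1 * φ (A p) ∂(gaussianReal 0 (‖k‖₊ ^ 2)).prod (P.map Z) := by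
        rw [← hlaw, integral_map hYZ hFc.aestronglyMeasurable]
    _ = ‖k‖ ^ 2 * ∫ p, fderiv ℝ φ (A p) a ∂(gaussianReal 0 (‖k‖₊ ^ 2)).prod (P.map Z) := by
        rw [integral_prod_symm _ hint₁, integral_prod_symm _ hint₂, ← integral_const_mul]
        simp_rw [hstein]
    _ = ∫ ω, ‖k‖ ^ 2 * fderiv ℝ φ (A (W k ω, Z ω)) a ∂P := by
        rw [← hlaw, integral_map hYZ hDc.aestronglyMeasurable, integral_const_mul]
    _ = _ := by
        refine integral_congr_ae ?_
        filter_upwards [hdecomp] with ω hω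
        rw [hω, ← smul_eq_mul, ← map_smul]
        congr 1
        ext l
        simp only [ha, Pi.smul_apply, smul_eq_mul]
        field_simp

/-- Gaussian integration by parts for a duality pairing of vector-valued cylindrical
functionals. -/
lemma integral_apply_fderiv [IsProbabilityMeasure P] (hW : IsIsonormal P W) {ι E : Type*}
    [Fintype ι] [NormedAddCommGroup E] [NormedSpace ℝ E] (h : ι → H) (k : H)
    {F : (ι → ℝ) → E} {G : (ι → ℝ) → E →L[ℝ] ℝ} (hF : ContDiff ℝ 1 F) (hG : ContDiff ℝ 1 G)
    {A A' B B' : ℝ} (hA : ∀ y, ‖F y‖ ≤ A) (hA' : ∀ y, ‖fderiv ℝ F y‖ ≤ A')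
    (hB : ∀ y, ‖G y‖ ≤ B) (hB' : ∀ y, ‖fderiv ℝ G y‖ ≤ B') :
    ∫ ω, G (fun l ↦ W (h l) ω) (fderiv ℝ F (fun l ↦ W (h l) ω) (fun l ↦ ⟪h l, k⟫)) ∂P
      = ∫ ω, W k ω * G (fun l ↦ W (h l) ω) (F (fun l ↦ W (h l) ω)) ∂P
        - ∫ ω, fderiv ℝ G (fun l ↦ W (h l) ω) (fun l ↦ ⟪h l, k⟫) (F (fun l ↦ W (h l) ω)) ∂P := by
  set c : ι → ℝ := fun l ↦ ⟪h l, k⟫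
  have hX := hW.aemeasurable_pi h
  have hFd := hF.differentiable one_ne_zero
  have hGd := hG.differentiable one_ne_zero
  have hFc := hF.continuous
  have hGc := hG.continuous
  have hF'c := hF.continuous_fderiv one_ne_zero
  have hG'c := hG.continuous_fderiv one_ne_zero
  have hderiv : ∀ y v, fderiv ℝ (fun y ↦ G y (F y)) y v
      = G y (fderiv ℝ F y v) + fderiv ℝ G y v (F y) := fun y v ↦ by
    simp [fderiv_clm_apply (hGd y) (hFd y)]
  have b₁ : ∀ y v, ‖G y (fderiv ℝ F y v)‖ ≤ B * (A' * ‖v‖) := fun y v ↦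
    ContinuousLinearMap.le_of_opNorm_le_of_le _ (hB y)
      (ContinuousLinearMap.le_of_opNorm_le _ (hA' y) v)
  have b₂ : ∀ y v, ‖fderiv ℝ G y v (F y)‖ ≤ B' * ‖v‖ * A := fun y v ↦
    ContinuousLinearMap.le_of_opNorm_le_of_le _
      (ContinuousLinearMap.le_of_opNorm_le _ (hB' y) v) (hA y)
  have nA' : 0 ≤ A' := (norm_nonneg _).trans (hA' 0)
  have nB : 0 ≤ B := (norm_nonneg _).trans (hB 0)
  have nA : 0 ≤ A := (norm_nonneg _).trans (hA 0)
  have nB' : 0 ≤ B' := (norm_nonneg (fderiv ℝ G 0)).trans (hB' 0)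
  have key := hW.integral_mul_comp h k (φ := fun y ↦ G y (F y)) (hG.clm_apply hF)
    (C := B * A) (C' := B * A' + B' * A)
    (fun y ↦ ContinuousLinearMap.le_of_opNorm_le_of_le _ (hB y) (hA y))
    (fun y ↦ ContinuousLinearMap.opNorm_le_bound _ (by positivity) fun v ↦ by
      rw [hderiv]
      refine (norm_add_le_of_le (b₁ y v) (b₂ y v)).trans_eq ?_
      ring)
  rw [key]
  simp_rw [hderiv]
  rw [integral_add, add_sub_cancel_right]
  · refine .of_bound ?_ (B * (A' * ‖c‖)) (ae_of_all _ fun ω ↦ b₁ _ c)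
    exact (show Continuous fun y ↦ G y (fderiv ℝ F y c) by fun_prop).comp_aestronglyMeasurable
      hX.aestronglyMeasurable
  · refine .of_bound ?_ (B' * ‖c‖ * A) (ae_of_all _ fun ω ↦ b₂ _ c)
    exact (show Continuous fun y ↦ fderiv ℝ G y c (F y) by fun_prop).comp_aestronglyMeasurable
      hX.aestronglyMeasurable

end IsIsonormal

namespace CbSmooth

variable {ι V : Type*} [Fintype ι] [NormedAddCommGroup V] [NormedSpace ℝ V] {n : ℕ}
  {f : ι → (Fin n → ℝ) → ℝ}

lemma contDiff_sum_smul (hf : ∀ i, CbSmooth (f i)) (x : ι → V) :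
    ContDiff ℝ 1 fun y ↦ ∑ i, f i y • x i :=
  .sum fun i _ ↦ ((hf i).1.of_le (by exact_mod_cast le_top)).smul contDiff_const

lemma exists_norm_sum_smul_le (hf : ∀ i, CbSmooth (f i)) (x : ι → V) :
    ∃ C, ∀ y, ‖∑ i, f i y • x i‖ ≤ C := by
  choose C hC using fun i ↦ (hf i).2 0
  refine ⟨∑ i, C i * ‖x i‖, fun y ↦ norm_sum_le_of_le _ fun i _ ↦ ?_⟩
  rw [norm_smul]
  gcongr
  simpa using hC i y

lemma hasFDerivAt_sum_smul (hf : ∀ i, CbSmooth (f i)) (x : ι → V) (y : Fin n → ℝ) :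
    HasFDerivAt (fun y ↦ ∑ i, f i y • x i) (∑ i, (fderiv ℝ (f i) y).smulRight (x i)) y :=
  .fun_sum fun i _ ↦ ((hf i).1.differentiable (by simp) y).hasFDerivAt.smul_const (x i)

lemma exists_norm_fderiv_sum_smul_le (hf : ∀ i, CbSmooth (f i)) (x : ι → V) :
    ∃ C, ∀ y, ‖fderiv ℝ (fun y ↦ ∑ i, f i y • x i) y‖ ≤ C := by
  choose C hC using fun i ↦ (hf i).2 1
  refine ⟨∑ i, C i * ‖x i‖, fun y ↦ ?_⟩
  rw [(hasFDerivAt_sum_smul hf x y).fderiv]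
  refine norm_sum_le_of_le _ fun i _ ↦ ?_
  rw [ContinuousLinearMap.norm_smulRight_apply]
  gcongr
  simpa [norm_iteratedFDeriv_one] using hC i y

lemma fderiv_sum_smul_apply (hf : ∀ i, CbSmooth (f i)) (x : ι → V) (y c : Fin n → ℝ) :
    fderiv ℝ (fun y ↦ ∑ i, f i y • x i) y c
      = ∑ i, ∑ j, (fderiv ℝ (f i) y (Pi.single j 1) * c j) • x i := by
  rw [(hasFDerivAt_sum_smul hf x y).fderiv, _root_.sum_apply]
  refine Finset.sum_congr rfl fun i _ ↦ ?_
  rw [ContinuousLinearMap.smulRight_apply, ← Finset.sum_smul]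
  congr 1
  conv_lhs => rw [pi_eq_sum_univ' c]
  simp [mul_comm]

end CbSmooth

/-- Integration by parts: for `F = ∑_i f_i(W h₁,…,W h_n) ⊗ x_i ∈ S(Ω) ⊗ E`,
`G = ∑_r g_r(W h₁,…,W h_n) ⊗ x*_r ∈ S(Ω) ⊗ E*` and `k ∈ H`,
`E⟨DF(k),G⟩ = E(W(k)⟨F,G⟩) − E⟨F,DG(k)⟩`. -/
theorem clark_ocone_statement8 {Ω H E : Type*} [MeasurableSpace Ω]
    [NormedAddCommGroup H] [InnerProductSpace ℝ H] [CompleteSpace H]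
    [NormedAddCommGroup E] [NormedSpace ℝ E] [CompleteSpace E]
    (P : Measure Ω) [IsProbabilityMeasure P]
    (W : H → Ω → ℝ) (hW : IsIsonormal P W)
    (m m' n : ℕ) (f : Fin m → (Fin n → ℝ) → ℝ) (g : Fin m' → (Fin n → ℝ) → ℝ)
    (hf : ∀ i, CbSmooth (f i)) (hg : ∀ r, CbSmooth (g r))
    (h : Fin n → H) (x : Fin m → E) (xs : Fin m' → E →L[ℝ] ℝ) (k : H) :
    ∫ ω, (∑ r, g r (fun l => W (h l) ω) • xs r)
        (∑ i, ∑ j, (fderiv ℝ (f i) (fun l => W (h l) ω) (Pi.single j 1) * ⟪h j, k⟫) • x i) ∂P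
    = ∫ ω, W k ω *
        ((∑ r, g r (fun l => W (h l) ω) • xs r) (∑ i, f i (fun l => W (h l) ω) • x i)) ∂P
      - ∫ ω, (∑ r, ∑ j, (fderiv ℝ (g r) (fun l => W (h l) ω) (Pi.single j 1) * ⟪h j, k⟫) • xs r)
          (∑ i, f i (fun l => W (h l) ω) • x i) ∂P := by
  obtain ⟨A, hA⟩ := CbSmooth.exists_norm_sum_smul_le hf x
  obtain ⟨A', hA'⟩ := CbSmooth.exists_norm_fderiv_sum_smul_le hf x
  obtain ⟨B, hB⟩ := CbSmooth.exists_norm_sum_smul_le hg xs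
  obtain ⟨B', hB'⟩ := CbSmooth.exists_norm_fderiv_sum_smul_le hg xs
  have key := hW.integral_apply_fderiv h k (CbSmooth.contDiff_sum_smul hf x)
    (CbSmooth.contDiff_sum_smul hg xs) hA hA' hB hB'
  simp_rw [CbSmooth.fderiv_sum_smul_apply hf, CbSmooth.fderiv_sum_smul_apply hg] at key
  exact key
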